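/- Let k ≥ 4 and 3 ≤ n ≤ k−1 be integers. Let σ_{n,k} be the cyclic permutation of P_k defined by σ_{n,k}(1) = n, σ_{n,k}(i) = i+1 for n ≤ i ≤ k−1, σ_{n,k}(k) = n−1, and σ_{n,k}(j) = j−1 for 2 ≤ j ≤ n−1, and let σ_{k,k} be the cyclic permutation of P_k with σ_{k,k}(1) = k and σ_{k,k}(j) = j−1 for 2 ≤ j ≤ k. Then σ_{n,k} and σ_{k,k} are right similar and two-sided similar, but not left similar; moreover the Petrie matrices M_{σ_{n,k}} and M_{σ_{k,k}} are not similar over ℝ, since they have distinct traces. -/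

import Mathlib

open Matrix

/-- `σ` is a permutation of `P_n = {1,…,n}`, viewed as a function `ℕ → ℕ`. -/
def IsPermOn (n : ℕ) (σ : ℕ → ℕ) : Prop :=
  Set.BijOn σ (Set.Icc 1 n) (Set.Icc 1 n)

/-- The Petrie matrix of a map `σ` on `P_n`: the `(n-1) × (n-1)` real matrix whose
`(i,j)` entry (with `1`-based indices) is `1` iff
`min (σ i) (σ (i+1)) ≤ j ≤ max (σ i) (σ (i+1)) - 1`, and `0` otherwise. -/
def petrie (n : ℕ) (σ : ℕ → ℕ) : Matrix (Fin (n - 1)) (Fin (n - 1)) ℝ :=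
  Matrix.of fun i j =>
    if min (σ (i.1 + 1)) (σ (i.1 + 2)) ≤ j.1 + 1 ∧
        j.1 + 1 ≤ max (σ (i.1 + 1)) (σ (i.1 + 2)) - 1 then 1 else 0

/-- Two square real matrices are similar if `B = P * A * P⁻¹` for some invertible `P`. -/
def MatSimilar {m : Type*} [Fintype m] [DecidableEq m] (A B : Matrix m m ℝ) : Prop :=
  ∃ P : Matrix m m ℝ, IsUnit P ∧ B = P * A * P⁻¹

/-- `σ'` (a permutation of `P_{k+n}`) is a right extension of `σ` (a permutation of `P_k`). -/
def IsRightExt (k n : ℕ) (σ σ' : ℕ → ℕ) : Prop :=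
  IsPermOn (k + n) σ' ∧
  (∀ i, 1 ≤ i → i ≤ k - 1 → σ' i = σ i) ∧
  ∃ t, k + 1 ≤ t ∧ t ≤ k + n ∧ σ' t = σ k ∧
    ∀ j, j ≠ t → k ≤ j → j ≤ k + n → k < σ' j

/-- `(σ', ρ')` is a synchronized right extension of `(σ, ρ)` to `P_{k+n}`. -/
def IsSyncRightExt (k n : ℕ) (σ ρ σ' ρ' : ℕ → ℕ) : Prop :=
  IsRightExt k n σ σ' ∧ IsRightExt k n ρ ρ' ∧
  ∃ t, k + 1 ≤ t ∧ t ≤ k + n ∧ σ' t = σ k ∧ ρ' t = ρ k ∧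
    ∀ i, i ≠ t → k ≤ i → i ≤ k + n → σ' i = ρ' i

/-- `σ'` (a permutation of `P_{m+k}`) is a left extension of `σ` (a permutation of `P_k`). -/
def IsLeftExt (k m : ℕ) (σ σ' : ℕ → ℕ) : Prop :=
  IsPermOn (m + k) σ' ∧
  (∀ i, 2 ≤ i → i ≤ k → σ' (m + i) = m + σ i) ∧
  ∃ s, 1 ≤ s ∧ s ≤ m ∧ σ' s = m + σ 1 ∧
    ∀ j, j ≠ s → 1 ≤ j → j ≤ m + 1 → σ' j < m + 1

/-- `(σ', ρ')` is a synchronized left extension of `(σ, ρ)` to `P_{m+k}`. -/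
def IsSyncLeftExt (k m : ℕ) (σ ρ σ' ρ' : ℕ → ℕ) : Prop :=
  IsLeftExt k m σ σ' ∧ IsLeftExt k m ρ ρ' ∧
  ∃ s, 1 ≤ s ∧ s ≤ m ∧ σ' s = m + σ 1 ∧ ρ' s = m + ρ 1 ∧
    ∀ i, i ≠ s → 1 ≤ i → i ≤ m + 1 → σ' i = ρ' i

/-- `σ'` (a permutation of `P_{m+k+n}`) is a two-sided extension of `σ` (a permutation of `P_k`). -/
def IsTwoSidedExt (k m n : ℕ) (σ σ' : ℕ → ℕ) : Prop :=
  IsPermOn (m + k + n) σ' ∧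
  (∀ i, 2 ≤ i → i ≤ k - 1 → σ' (m + i) = m + σ i) ∧
  (∃ s, 1 ≤ s ∧ s ≤ m ∧ σ' s = m + σ 1 ∧
    ∀ i, i ≠ s → 1 ≤ i → i ≤ m + 1 → σ' i < m + 1) ∧
  (∃ t, m + k + 1 ≤ t ∧ t ≤ m + k + n ∧ σ' t = m + σ k ∧
    ∀ j, j ≠ t → m + k ≤ j → j ≤ m + k + n → m + k < σ' j)

/-- `(σ', ρ')` is a synchronized two-sided extension of `(σ, ρ)` to `P_{m+k+n}`. -/
def IsSyncTwoSidedExt (k m n : ℕ) (σ ρ σ' ρ' : ℕ → ℕ) : Prop :=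
  IsTwoSidedExt k m n σ σ' ∧ IsTwoSidedExt k m n ρ ρ' ∧
  ∃ s t, 1 ≤ s ∧ s ≤ m ∧ m + k + 1 ≤ t ∧ t ≤ m + k + n ∧
    σ' s = m + σ 1 ∧ ρ' s = m + ρ 1 ∧ σ' t = m + σ k ∧ ρ' t = m + ρ k ∧
    ∀ i, i ≠ s → i ≠ t →
      ((1 ≤ i ∧ i ≤ m + 1) ∨ (m + k ≤ i ∧ i ≤ m + k + n)) → σ' i = ρ' i

/-- `σ` and `ρ` (permutations of `P_k`) are right similar. -/
def RightSimilar (k : ℕ) (σ ρ : ℕ → ℕ) : Prop :=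
  ∀ n, 1 ≤ n → ∀ σ' ρ' : ℕ → ℕ, IsSyncRightExt k n σ ρ σ' ρ' →
    MatSimilar (petrie (k + n) σ') (petrie (k + n) ρ')

/-- `σ` and `ρ` (permutations of `P_k`) are left similar. -/
def LeftSimilar (k : ℕ) (σ ρ : ℕ → ℕ) : Prop :=
  ∀ m, 1 ≤ m → ∀ σ' ρ' : ℕ → ℕ, IsSyncLeftExt k m σ ρ σ' ρ' →
    MatSimilar (petrie (m + k) σ') (petrie (m + k) ρ')

/-- `σ` and `ρ` (permutations of `P_k`) are two-sided similar. -/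
def TwoSidedSimilar (k : ℕ) (σ ρ : ℕ → ℕ) : Prop :=
  ∀ m n, 1 ≤ m → 1 ≤ n → ∀ σ' ρ' : ℕ → ℕ, IsSyncTwoSidedExt k m n σ ρ σ' ρ' →
    MatSimilar (petrie (m + k + n) σ') (petrie (m + k + n) ρ')

/-- `σ` and `ρ` (permutations of `P_k`) are right weakly similar. -/
def RightWeaklySimilar (k : ℕ) (σ ρ : ℕ → ℕ) : Prop :=
  ∀ n, 1 ≤ n → ∀ σ' ρ' : ℕ → ℕ, IsSyncRightExt k n σ ρ σ' ρ' →
    (petrie (k + n) σ').charpoly = (petrie (k + n) ρ').charpoly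

/-- The cyclic permutation `σ_{n,k}` of `P_k`:
`σ_{n,k}(1) = n`, `σ_{n,k}(i) = i+1` for `n ≤ i ≤ k-1`, `σ_{n,k}(k) = n-1`,
and `σ_{n,k}(j) = j-1` for `2 ≤ j ≤ n-1`.
(For `n = 2` this is `1→2→⋯→k→1`; for `n = k` this is `1→k→k-1→⋯→2→1`.) -/
def sigmaNK (n k : ℕ) : ℕ → ℕ := fun i =>
  if i = 1 then n
  else if n ≤ i ∧ i ≤ k - 1 then i + 1
  else if i = k then n - 1
  else if 2 ≤ i ∧ i ≤ n - 1 then i - 1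
  else i


/-- The algebraic heart: construction of the intertwining potential `G`. -/
lemma core_potential {V : Type*} [AddCommGroup V] [Module ℝ V]
    (T Q : Module.End ℝ V) (F : ℕ → V) (σ ρ : ℕ → ℕ) (m n d N : ℕ)
    (hn : 3 ≤ n) (hd : 1 ≤ d) (hN : m + (n + d) + 1 ≤ N)
    (hQ1 : ∀ x, Q ((T ^ d) x) = x) (hQ2 : ∀ x, (T ^ d) (Q x) = x)
    (hQT : ∀ x, T (Q x) = Q (T x))
    (hT : ∀ i, 1 ≤ i → i < N → T (F (i + 1) - F i)
      = F (max (ρ i) (ρ (i + 1))) - F (min (ρ i) (ρ (i + 1))))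
    (h1 : ∀ i, 1 ≤ i → i ≤ m + 1 →
      (σ i = ρ i ∧ ρ i ≤ m) ∨ (σ i = m + n ∧ ρ i = m + (n + d)))
    (h2 : ∀ i, m + (n + d) ≤ i → i ≤ N →
      (σ i = ρ i ∧ m + (n + d) < ρ i) ∨ (σ i = m + n - 1 ∧ ρ i = m + (n + d) - 1))
    (hw : σ (m + (n + d)) = ρ (m + (n + d)) ∧ m + (n + d) < ρ (m + (n + d)))
    (h3 : ∀ i, m + 2 ≤ i → i ≤ m + (n + d) - 1 → ρ i = i - 1)
    (h4 : ∀ i, m + 2 ≤ i → i ≤ m + n - 1 → σ i = i - 1)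
    (h5 : ∀ i, m + n ≤ i → i ≤ m + (n + d) - 1 → σ i = i + 1) :
    ∃ G : ℕ → V,
      (∀ i, 1 ≤ i → i < N → T (G (i + 1) - G i)
        = G (max (σ i) (σ (i + 1))) - G (min (σ i) (σ (i + 1)))) ∧
      (∀ W : Submodule ℝ V, (∀ x ∈ W, T x ∈ W) →
        (∀ i, 1 ≤ i → i < N → G (i + 1) - G i ∈ W) →
        ∀ i, 1 ≤ i → i < N → F (i + 1) - F i ∈ W) := by
  obtain ⟨hw1, hw2⟩ := hw
  generalize hwdef : ρ (m + (n + d)) = w at hw1 hw2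
  have hTp : ∀ x, T ((T ^ (d - 1)) x) = (T ^ d) x := by
    intro x
    rw [← Module.End.mul_apply, ← pow_succ', show d - 1 + 1 = d by omega]
  -- action on the middle edges
  have hmid : ∀ i, m + 2 ≤ i → i + 1 ≤ m + (n + d) - 1 →
      T (F (i + 1) - F i) = F i - F (i - 1) := by
    intro i hi1 hi2
    rw [hT i (by omega) (by omega), h3 i hi1 (by omega), h3 (i + 1) (by omega) (by omega)]
    congr 2 <;> omega
  have hlast : T (F (m + (n + d)) - F (m + (n + d) - 1)) = F w - F (m + (n + d) - 2) := by
    have := hT (m + (n + d) - 1) (by omega) (by omega)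
    rw [show m + (n + d) - 1 + 1 = m + (n + d) by omega, hwdef,
      h3 (m + (n + d) - 1) (by omega) (by omega)] at this
    rw [this]
    congr 2 <;> omega
  have htail : ∀ j, j + 3 ≤ n + d →
      T (F (m + (n + d)) - F (m + (n + d) - 1 - j)) = F w - F (m + (n + d) - 2 - j) := by
    intro j
    induction j with
    | zero => intro _; simpa using hlast
    | succ j ih =>
      intro hj
      have e1 := ih (by omega)
      have e2 := hmid (m + (n + d) - 1 - (j + 1)) (by omega) (by omega)
      rw [show m + (n + d) - 1 - (j + 1) + 1 = m + (n + d) - 1 - j by omega,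
        show m + (n + d) - 1 - (j + 1) = m + (n + d) - 2 - j by omega,
        show m + (n + d) - 2 - j - 1 = m + (n + d) - 2 - (j + 1) by omega] at e2
      rw [show m + (n + d) - 1 - (j + 1) = m + (n + d) - 2 - j by omega]
      calc _ = T (F (m + (n + d)) - F (m + (n + d) - 1 - j))
          + T (F (m + (n + d) - 1 - j) - F (m + (n + d) - 2 - j)) := by
            rw [← map_add]; congr 1; abel
        _ = _ := by rw [e1, e2]; abel
  have htail' : ∀ a, 2 ≤ a → a + 1 ≤ n + d →
      T (F (m + (n + d)) - F (m + a)) = F w - F (m + a - 1) := by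
    intro a ha1 ha2
    have := htail (n + d - 1 - a) (by omega)
    rw [show m + (n + d) - 1 - (n + d - 1 - a) = m + a by omega,
      show m + (n + d) - 2 - (n + d - 1 - a) = m + a - 1 by omega] at this
    exact this
  -- powers along the chain
  have hchain : ∀ j, j + 3 ≤ n + d →
      (T ^ j) (F (m + 1 + j + 1) - F (m + 1 + j)) = F (m + 2) - F (m + 1) := by
    intro j
    induction j with
    | zero => intro _; simp
    | succ j ih =>
      intro hj
      have e2 := hmid (m + 1 + (j + 1)) (by omega) (by omega)
      rw [pow_succ, Module.End.mul_apply, e2, ← ih (by omega)]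
      rfl
  set R : V := F w - F (m + (n + d)) with hR
  have hkey : ∀ j, j + 3 ≤ n + d →
      (T ^ j) (F (m + (n + d)) - F (m + j + 1))
        = F (m + (n + d)) - F (m + 1) + ∑ i ∈ Finset.range j, (T ^ i) R := by
    intro j
    induction j with
    | zero => intro _; simp
    | succ j ih =>
      intro hj
      have e1 := htail' (j + 2) (by omega) (by omega)
      rw [pow_succ, Module.End.mul_apply, show m + (j + 1) + 1 = m + (j + 2) by omega, e1,
        Finset.sum_range_succ, ← add_assoc (F (m + (n + d)) - F (m + 1)), ← ih (by omega),
        ← map_add]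
      congr 1
      rw [show m + (j + 2) - 1 = m + j + 1 by omega, hR]; abel
  set c : V := Q (F (m + 1)) - F (m + d + 1) with hc
  let G : ℕ → V := fun x =>
    if x ≤ m + 1 then Q (F x) else if x ≤ m + n - 1 then F (x + d) + c
    else if x ≤ m + (n + d) then
      Q (F (m + (n + d))) + ∑ j ∈ Finset.range (x - (m + n)), Q ((T ^ j) R)
    else F x + c
  have G1 : ∀ x, x ≤ m + 1 → G x = Q (F x) := fun x hx => by simp only [G, if_pos hx]
  have G2 : ∀ x, m + 1 ≤ x → x ≤ m + n - 1 → G x = F (x + d) + c := by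
    intro x hx1 hx2
    rcases Nat.eq_or_lt_of_le hx1 with h | h
    · subst h
      rw [G1 _ le_rfl, hc, show m + 1 + d = m + d + 1 by omega]; abel
    · simp only [G, if_neg (show ¬ x ≤ m + 1 by omega), if_pos hx2]
  have G3 : ∀ j, j ≤ d → G (m + n + j) =
      Q (F (m + (n + d))) + ∑ i ∈ Finset.range j, Q ((T ^ i) R) := by
    intro j hj
    simp only [G, if_neg (show ¬ m + n + j ≤ m + 1 by omega),
      if_neg (show ¬ m + n + j ≤ m + n - 1 by omega),
      if_pos (show m + n + j ≤ m + (n + d) by omega), show m + n + j - (m + n) = j by omega]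
  have G4 : ∀ x, m + (n + d) ≤ x → G x = F x + c := by
    intro x hx
    rcases Nat.eq_or_lt_of_le hx with h | h
    · subst h
      have e := hkey d (by omega)
      have e' := congrArg Q e
      rw [hQ1, map_add, map_sub, map_sum] at e'
      have := G3 d le_rfl
      rw [show m + n + d = m + (n + d) by omega] at this
      rw [this, hc]
      have e'' : ∑ i ∈ Finset.range d, Q ((T ^ i) R) = F (m + (n + d)) - F (m + d + 1)
        - (Q (F (m + (n + d))) - Q (F (m + 1))) := by rw [e']; abel
      rw [e'']; abel
    · simp only [G, if_neg (show ¬ x ≤ m + 1 by omega),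
        if_neg (show ¬ x ≤ m + n - 1 by omega), if_neg (show ¬ x ≤ m + (n + d) by omega)]
  have hGL : ∀ i, 1 ≤ i → i ≤ m + 1 → G (σ i) = Q (F (ρ i)) := by
    intro i hi1 hi2
    rcases h1 i hi1 hi2 with ⟨a, b⟩ | ⟨a, b⟩
    · rw [a]; exact G1 _ (by omega)
    · rw [a, b]; simpa using G3 0 (by omega)
  have hGR : ∀ i, m + (n + d) ≤ i → i ≤ N → G (σ i) = F (ρ i) + c := by
    intro i hi1 hi2
    rcases h2 i hi1 hi2 with ⟨a, b⟩ | ⟨a, b⟩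
    · rw [a]; exact G4 _ (by omega)
    · rw [a, b, G2 _ (by omega) (by omega), show m + n - 1 + d = m + (n + d) - 1 by omega]
  -- the edge `m+1`
  have hρm2 : ρ (m + 2) = m + 1 := by rw [h3 (m + 2) (by omega) (by omega)]; omega
  have hσm2 : σ (m + 2) = m + 1 := by rw [h4 (m + 2) (by omega) (by omega)]; omega
  have hfirst : G (max (σ (m + 1)) (σ (m + 1 + 1))) - G (min (σ (m + 1)) (σ (m + 1 + 1)))
      = Q (T (F (m + 1 + 1) - F (m + 1))) := by
    rw [hT (m + 1) (by omega) (by omega), hρm2, hσm2, map_sub]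
    have g1 := hGL (m + 1) (by omega) le_rfl
    have g2 := G1 (m + 1) le_rfl
    rcases h1 (m + 1) (by omega) le_rfl with ⟨a, b⟩ | ⟨a, b⟩
    · rw [max_eq_right (by omega), max_eq_right (by omega), min_eq_left (by omega),
        min_eq_left (by omega), g1, g2]
    · rw [max_eq_left (by omega), max_eq_left (by omega), min_eq_right (by omega),
        min_eq_right (by omega), g1, g2]
  have hQL : Q (T (F (m + 1 + 1) - F (m + 1))) = F (m + d + 1) - F (m + d) := by
    have e := hchain (d - 1) (by omega)
    rw [show m + 1 + (d - 1) = m + d by omega] at e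
    rw [show m + 1 + 1 = m + 2 by omega, ← e, hTp, hQ1]
  have hinter : ∀ i, 1 ≤ i → i < N → T (G (i + 1) - G i)
        = G (max (σ i) (σ (i + 1))) - G (min (σ i) (σ (i + 1))) := by
    intro i hi1 hi2
    rcases Nat.lt_or_ge i (m + 1) with hA | hA
    · -- left block
      rw [G1 i (by omega), G1 (i + 1) (by omega), ← map_sub, hQT, hT i hi1 hi2, map_sub]
      have g1 := hGL i hi1 (by omega)
      have g2 := hGL (i + 1) (by omega) (by omega)
      rcases le_total (ρ i) (ρ (i + 1)) with h | h
      · have h' : σ i ≤ σ (i + 1) := by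
          have := h1 i hi1 (by omega)
          have := h1 (i + 1) (by omega) (by omega)
          omega
        rw [max_eq_right h, min_eq_left h, max_eq_right h', min_eq_left h', g1, g2]
      · have h' : σ (i + 1) ≤ σ i := by
          have := h1 i hi1 (by omega)
          have := h1 (i + 1) (by omega) (by omega)
          omega
        rw [max_eq_left h, min_eq_right h, max_eq_left h', min_eq_right h', g1, g2]
    rcases Nat.eq_or_lt_of_le hA with hB | hB
    · -- the edge m+1
      subst hB
      rw [hfirst, hQL, G2 (m + 1 + 1) (by omega) (by omega), G2 (m + 1) (by omega) (by omega),
        add_sub_add_right_eq_sub]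
      have e := hmid (m + d + 1) (by omega) (by omega)
      rw [show m + 1 + 1 + d = m + d + 1 + 1 by omega, show m + 1 + d = m + d + 1 by omega, e]
      rfl
    rcases Nat.lt_or_ge i (m + n - 1) with hC | hC
    · rw [h4 i (by omega) (by omega), h4 (i + 1) (by omega) (by omega),
        max_eq_right (by omega), min_eq_left (by omega), G2 (i + 1) (by omega) (by omega),
        show i + 1 - 1 = i by omega,
        G2 i (by omega) (by omega), G2 (i - 1) (by omega) (by omega),
        add_sub_add_right_eq_sub, add_sub_add_right_eq_sub]
      have e := hmid (i + d) (by omega) (by omega)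
      rw [show i + 1 + d = i + d + 1 by omega, e, show i + d - 1 = i - 1 + d by omega]
    rcases Nat.eq_or_lt_of_le hC with hD | hD
    · -- the turning edge
      subst hD
      rw [show m + n - 1 + 1 = m + n by omega, h4 (m + n - 1) (by omega) (by omega),
        h5 (m + n) (by omega) (by omega), max_eq_right (by omega), min_eq_left (by omega),
        G2 (m + n - 1) (by omega) (by omega), G2 (m + n - 1 - 1) (by omega) (by omega)]
      have g0 := G3 0 (by omega)
      have g1 := G3 1 (by omega)
      simp only [Finset.range_zero, Finset.sum_empty, add_zero, Finset.range_one,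
        Finset.sum_singleton, pow_zero, Module.End.one_apply] at g0 g1
      rw [g0, g1]
      -- T applied to the whole middle
      have e1 := htail' 2 (by omega) (by omega)
      have e2 := htail' (n + d - 1) (by omega) (by omega)
      have e3 := htail' (d + 1) (by omega) (by omega)
      rw [show m + 2 - 1 = m + 1 by omega] at e1
      rw [show m + (n + d - 1) - 1 = m + n - 1 - 1 + d by omega,
        show m + (n + d - 1) = m + n - 1 + d by omega] at e2
      rw [show m + (d + 1) - 1 = m + d by omega, show m + (d + 1) = m + d + 1 by omega] at e3
      rw [show m + 1 + 1 = m + 2 by omega] at hQL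
      have e4 : T (Q (F (m + (n + d))) - Q (F (m + 1)))
          = Q (F w - F (m + 1)) + (F (m + d + 1) - F (m + d)) := by
        rw [← map_sub, hQT, ← hQL, ← e1, ← map_add, ← map_add]
        congr 2; abel
      have e5 : T (F (m + n - 1 + d) - F (m + d + 1)) = F (m + n - 1 - 1 + d) - F (m + d) := by
        calc _ = T (F (m + (n + d)) - F (m + d + 1)) - T (F (m + (n + d)) - F (m + n - 1 + d)) := by
              rw [← map_sub]; congr 1; abel
          _ = _ := by rw [e2, e3]; abel
      calc _ = T (Q (F (m + (n + d))) - Q (F (m + 1))) - T (F (m + n - 1 + d) - F (m + d + 1)) := by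
            rw [← map_sub, hc]; congr 1; abel
        _ = _ := by rw [e4, e5, hc, hR, map_sub, map_sub]; abel
    rcases Nat.lt_or_ge i (m + (n + d) - 1) with hE | hE
    · obtain ⟨j, rfl⟩ : ∃ j, i = m + n + j := ⟨i - (m + n), by omega⟩
      rw [h5 (m + n + j) (by omega) (by omega), h5 (m + n + j + 1) (by omega) (by omega),
        max_eq_right (by omega), min_eq_left (by omega)]
      have g0 := G3 j (by omega)
      have g1 := G3 (j + 1) (by omega)
      have g2 := G3 (j + 1 + 1) (by omega)
      rw [← add_assoc, Finset.sum_range_succ] at g1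
      rw [← add_assoc, ← add_assoc, Finset.sum_range_succ, Finset.sum_range_succ] at g2
      have e : T (Q ((T ^ j) R)) = Q ((T ^ (j + 1)) R) := by
        rw [hQT, pow_succ', Module.End.mul_apply]
      rw [g2, g1, g0]
      calc _ = T (Q ((T ^ j) R)) := by congr 1; abel
        _ = _ := by rw [e]; abel
    rcases Nat.eq_or_lt_of_le hE with hF | hF
    · subst hF
      have g0 := G3 (d - 1) (by omega)
      have g1 := G3 (d - 1 + 1) (by omega)
      rw [Finset.sum_range_succ, show m + n + (d - 1 + 1) = m + (n + d) by omega] at g1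
      rw [show m + n + (d - 1) = m + (n + d) - 1 by omega] at g0
      rw [show m + (n + d) - 1 + 1 = m + (n + d) by omega, hw1,
        h5 (m + (n + d) - 1) (by omega) (by omega),
        show m + (n + d) - 1 + 1 = m + (n + d) by omega,
        max_eq_right (by omega), min_eq_left (by omega), G4 w (by omega)]
      have g4 := G4 (m + (n + d)) le_rfl
      have e : T (Q ((T ^ (d - 1)) R)) = R := by
        rw [hQT, hTp, hQ1]
      calc _ = T (Q ((T ^ (d - 1)) R)) := by rw [g0, g1]; congr 1; abel
        _ = _ := by rw [e, g4, hR]; abel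
    · -- right block
      rw [G4 i (by omega), G4 (i + 1) (by omega), add_sub_add_right_eq_sub, hT i hi1 hi2]
      have g1 := hGR i (by omega) (by omega)
      have g2 := hGR (i + 1) (by omega) (by omega)
      rcases le_total (ρ i) (ρ (i + 1)) with h | h
      · have h' : σ i ≤ σ (i + 1) := by
          have := h2 i (by omega) (by omega)
          have := h2 (i + 1) (by omega) (by omega)
          omega
        rw [max_eq_right h, min_eq_left h, max_eq_right h', min_eq_left h', g1, g2]; abel
      · have h' : σ (i + 1) ≤ σ i := by
          have := h2 i (by omega) (by omega)
          have := h2 (i + 1) (by omega) (by omega)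
          omega
        rw [max_eq_left h, min_eq_right h, max_eq_left h', min_eq_right h', g1, g2]; abel
  refine ⟨G, hinter, ?_⟩
  intro W hW hG
  have hWp : ∀ j : ℕ, ∀ x ∈ W, (T ^ j) x ∈ W := by
    intro j
    induction j with
    | zero => intro x hx; simpa using hx
    | succ j ih => intro x hx; rw [pow_succ', Module.End.mul_apply]; exact hW _ (ih x hx)
  have htop : F (m + (n + d) - 1) - F (m + (n + d) - 2) ∈ W := by
    have := hG (m + n - 2) (by omega) (by omega)
    rw [G2 (m + n - 2) (by omega) (by omega), G2 (m + n - 2 + 1) (by omega) (by omega),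
      add_sub_add_right_eq_sub] at this
    rwa [show m + n - 2 + 1 + d = m + (n + d) - 1 by omega,
      show m + n - 2 + d = m + (n + d) - 2 by omega] at this
  have hdown : ∀ j, j + 3 ≤ n + d →
      F (m + (n + d) - 1 - j) - F (m + (n + d) - 2 - j) ∈ W := by
    intro j
    induction j with
    | zero => intro _; simpa using htop
    | succ j ih =>
      intro hj
      have e := hmid (m + (n + d) - 2 - j) (by omega) (by omega)
      have := hW _ (ih (by omega))
      rw [show m + (n + d) - 1 - j = m + (n + d) - 2 - j + 1 by omega, e] at this
      rwa [show m + (n + d) - 1 - (j + 1) = m + (n + d) - 2 - j by omega,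
        show m + (n + d) - 2 - (j + 1) = m + (n + d) - 2 - j - 1 by omega]
  intro i hi1 hi2
  rcases Nat.lt_or_ge i (m + 1) with hA | hA
  · have := hWp d _ (hG i hi1 hi2)
    rwa [G1 i (by omega), G1 (i + 1) (by omega), ← map_sub, hQ2] at this
  rcases Nat.lt_or_ge i (m + (n + d) - 1) with hB | hB
  · have := hdown (m + (n + d) - 2 - i) (by omega)
    rwa [show m + (n + d) - 1 - (m + (n + d) - 2 - i) = i + 1 by omega,
      show m + (n + d) - 2 - (m + (n + d) - 2 - i) = i by omega] at this
  rcases Nat.eq_or_lt_of_le hB with hC | hC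
  · subst hC
    have hs : ∀ j, j ≤ d + 1 → G (m + n - 1 + j) - G (m + n - 1) ∈ W := by
      intro j
      induction j with
      | zero => intro _; simp
      | succ j ih =>
        intro hj
        have := W.add_mem (hG (m + n - 1 + j) (by omega) (by omega)) (ih (by omega))
        rwa [sub_add_sub_cancel] at this
    have := hs (d + 1) le_rfl
    rw [show m + n - 1 + (d + 1) = m + (n + d) by omega, G4 _ le_rfl,
      G2 (m + n - 1) (by omega) (by omega), add_sub_add_right_eq_sub] at this
    rwa [show m + (n + d) - 1 + 1 = m + (n + d) by omega,
      show m + (n + d) - 1 = m + n - 1 + d by omega]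
  · have := hG i hi1 hi2
    rwa [G4 i (by omega), G4 (i + 1) (by omega), add_sub_add_right_eq_sub] at this

/-- The potential of the vertex `a`: the sum of all unit edges to the left of `a`. -/
def pot (N a : ℕ) : Fin (N - 1) → ℝ := fun j => if j.1 + 1 < a then 1 else 0

lemma pot_edge (N i : ℕ) (h1 : 1 ≤ i) (h2 : i < N) :
    pot N (i + 1) - pot N i = Pi.single (⟨i - 1, by omega⟩ : Fin (N - 1)) (1 : ℝ) := by
  ext j
  simp only [pot, Pi.sub_apply, Pi.single_apply, Fin.ext_iff]
  by_cases h : j.1 = i - 1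
  · rw [if_pos (by omega), if_neg (by omega), if_pos h]; norm_num
  · rw [if_neg h]
    by_cases h' : j.1 + 1 < i
    · rw [if_pos (by omega), if_pos h']; norm_num
    · rw [if_neg (by omega), if_neg h']; norm_num

lemma petrie_row (N : ℕ) (σ : ℕ → ℕ) (i : Fin (N - 1)) :
    petrie N σ i = pot N (max (σ (i.1 + 1)) (σ (i.1 + 2)))
      - pot N (min (σ (i.1 + 1)) (σ (i.1 + 2))) := by
  ext j
  have hle : min (σ (i.1 + 1)) (σ (i.1 + 2)) ≤ max (σ (i.1 + 1)) (σ (i.1 + 2)) :=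
    le_trans (min_le_left _ _) (le_max_left _ _)
  simp only [petrie, Matrix.of_apply, pot, Pi.sub_apply]
  generalize min (σ (i.1 + 1)) (σ (i.1 + 2)) = a at *
  generalize max (σ (i.1 + 1)) (σ (i.1 + 2)) = b at *
  split_ifs <;> first | (exfalso; omega) | norm_num

lemma petrie_edge (N : ℕ) (σ : ℕ → ℕ) (i : ℕ) (h1 : 1 ≤ i) (h2 : i < N) :
    (petrie N σ).vecMulLinear (pot N (i + 1) - pot N i)
      = pot N (max (σ i) (σ (i + 1))) - pot N (min (σ i) (σ (i + 1))) := by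
  rw [pot_edge N i h1 h2, Matrix.vecMulLinear_apply, Matrix.single_one_vecMul]
  have := petrie_row N σ ⟨i - 1, by omega⟩
  simp only [show i - 1 + 1 = i by omega, show i - 1 + 2 = i + 1 by omega] at this
  exact this

lemma submodule_eq_top_of_edges (N : ℕ) (W : Submodule ℝ (Fin (N - 1) → ℝ))
    (h : ∀ i, 1 ≤ i → i < N → pot N (i + 1) - pot N i ∈ W) : W = ⊤ := by
  rw [eq_top_iff, ← (Pi.basisFun ℝ (Fin (N - 1))).span_eq, Submodule.span_le]
  rintro _ ⟨j, rfl⟩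
  have := h (j.1 + 1) (by omega) (by omega)
  rw [pot_edge N _ (by omega) (by omega)] at this
  simpa using this

lemma petrie_surjective (N : ℕ) (ρ : ℕ → ℕ) (hρ : IsPermOn N ρ) :
    Function.Surjective (petrie N ρ).vecMulLinear := by
  rw [← LinearMap.range_eq_top]
  set W := LinearMap.range (petrie N ρ).vecMulLinear with hW
  have step : ∀ i, 1 ≤ i → i < N → pot N (ρ (i + 1)) - pot N (ρ i) ∈ W := by
    intro i h1 h2
    have hm : (petrie N ρ).vecMulLinear (pot N (i + 1) - pot N i) ∈ W := ⟨_, rfl⟩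
    rw [petrie_edge N ρ i h1 h2] at hm
    rcases le_total (ρ i) (ρ (i + 1)) with h | h
    · rwa [max_eq_right h, min_eq_left h] at hm
    · rw [max_eq_left h, min_eq_right h] at hm
      simpa using W.neg_mem hm
  have base : ∀ j, j + 1 ≤ N → pot N (ρ (j + 1)) - pot N (ρ 1) ∈ W := by
    intro j
    induction j with
    | zero => intro _; simp
    | succ j ih =>
      intro hj
      have := W.add_mem (step (j + 1) (by omega) (by omega)) (ih (by omega))
      rwa [sub_add_sub_cancel] at this
  have all : ∀ a, 1 ≤ a → a ≤ N → pot N a - pot N (ρ 1) ∈ W := by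
    intro a h1 h2
    obtain ⟨x, hx, rfl⟩ := hρ.surjOn (show a ∈ Set.Icc 1 N from ⟨h1, h2⟩)
    have := base (x - 1) (by have := hx.1; have := hx.2; omega)
    rwa [show x - 1 + 1 = x by have := hx.1; omega] at this
  apply submodule_eq_top_of_edges
  intro i h1 h2
  have := W.sub_mem (all (i + 1) (by omega) (by omega)) (all i h1 (by omega))
  rwa [sub_sub_sub_cancel_right] at this

lemma similar_of_sync (σ ρ : ℕ → ℕ) (m n d N : ℕ)
    (hn : 3 ≤ n) (hd : 1 ≤ d) (hN : m + (n + d) + 1 ≤ N)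
    (hσ : IsPermOn N σ) (hρ : IsPermOn N ρ)
    (h1 : ∀ i, 1 ≤ i → i ≤ m + 1 →
      (σ i = ρ i ∧ ρ i ≤ m) ∨ (σ i = m + n ∧ ρ i = m + (n + d)))
    (h2 : ∀ i, m + (n + d) ≤ i → i ≤ N →
      (σ i = ρ i ∧ m + (n + d) < ρ i) ∨ (σ i = m + n - 1 ∧ ρ i = m + (n + d) - 1))
    (hw : σ (m + (n + d)) = ρ (m + (n + d)) ∧ m + (n + d) < ρ (m + (n + d)))
    (h3 : ∀ i, m + 2 ≤ i → i ≤ m + (n + d) - 1 → ρ i = i - 1)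
    (h4 : ∀ i, m + 2 ≤ i → i ≤ m + n - 1 → σ i = i - 1)
    (h5 : ∀ i, m + n ≤ i → i ≤ m + (n + d) - 1 → σ i = i + 1) :
    MatSimilar (petrie N σ) (petrie N ρ) := by
  set T : Module.End ℝ (Fin (N - 1) → ℝ) := (petrie N ρ).vecMulLinear with hTdef
  have hsurj : Function.Surjective T := petrie_surjective N ρ hρ
  have hinj : Function.Injective T := LinearMap.injective_iff_surjective.mpr hsurj
  obtain ⟨u, hu⟩ := (Module.End.isUnit_iff T).mpr ⟨hinj, hsurj⟩
  set Q : Module.End ℝ (Fin (N - 1) → ℝ) := ((u⁻¹ ^ d : (Module.End ℝ (Fin (N - 1) → ℝ))ˣ) :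
    Module.End ℝ (Fin (N - 1) → ℝ)) with hQdef
  have q1 : Q * T ^ d = 1 := by
    rw [hQdef, ← hu, ← Units.val_pow_eq_pow_val, ← Units.val_mul]; simp
  have q2 : T ^ d * Q = 1 := by
    rw [hQdef, ← hu, ← Units.val_pow_eq_pow_val, ← Units.val_mul]; simp
  have q3 : T * Q = Q * T := by
    rw [hQdef, ← hu, ← Units.val_mul, ← Units.val_mul]
    congr 1
    exact ((Commute.refl u).inv_right.pow_right d).eq
  obtain ⟨G, hG1, hG2⟩ := core_potential T Q (pot N) σ ρ m n d N hn hd hN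
    (fun x => by rw [← Module.End.mul_apply, q1]; rfl)
    (fun x => by rw [← Module.End.mul_apply, q2]; rfl)
    (fun x => by rw [← Module.End.mul_apply, q3]; rfl)
    (fun i a b => petrie_edge N ρ i a b) h1 h2 hw h3 h4 h5
  let P : Matrix (Fin (N - 1)) (Fin (N - 1)) ℝ := fun i => G (i.1 + 2) - G (i.1 + 1)
  have hP1 : ∀ i, 1 ≤ i → i < N → P.vecMulLinear (pot N (i + 1) - pot N i) = G (i + 1) - G i := by
    intro i a b
    rw [pot_edge N i a b, Matrix.vecMulLinear_apply, Matrix.single_one_vecMul]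
    change G (i - 1 + 2) - G (i - 1 + 1) = _
    rw [show i - 1 + 1 = i by omega, show i - 1 + 2 = i + 1 by omega]
  have hP2 : ∀ j, j + 1 ≤ N → P.vecMulLinear (pot N (j + 1) - pot N 1) = G (j + 1) - G 1 := by
    intro j
    induction j with
    | zero => intro _; simp
    | succ j ih =>
      intro hj
      rw [← sub_add_sub_cancel _ (pot N (j + 1)) _, map_add, ih (by omega),
        hP1 (j + 1) (by omega) (by omega), sub_add_sub_cancel]
  have hP3 : ∀ a b, 1 ≤ a → a ≤ N → 1 ≤ b → b ≤ N →
      P.vecMulLinear (pot N b - pot N a) = G b - G a := by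
    intro a b a1 a2 b1 b2
    have ea := hP2 (a - 1) (by omega)
    have eb := hP2 (b - 1) (by omega)
    rw [show a - 1 + 1 = a by omega] at ea
    rw [show b - 1 + 1 = b by omega] at eb
    rw [← sub_sub_sub_cancel_right _ _ (pot N 1), map_sub, ea, eb, sub_sub_sub_cancel_right]
  have hcomm : petrie N σ * P = P * petrie N ρ := by
    ext i j
    rw [Matrix.mul_apply_eq_vecMul, Matrix.mul_apply_eq_vecMul]
    have hi := i.2
    have m1 := hσ.mapsTo (show i.1 + 1 ∈ Set.Icc 1 N from ⟨by omega, by omega⟩)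
    have m2 := hσ.mapsTo (show i.1 + 2 ∈ Set.Icc 1 N from ⟨by omega, by omega⟩)
    have e1 : petrie N σ i ᵥ* P = G (max (σ (i.1 + 1)) (σ (i.1 + 2)))
        - G (min (σ (i.1 + 1)) (σ (i.1 + 2))) := by
      rw [petrie_row]
      have := m1.1
      have := m1.2
      have := m2.1
      have := m2.2
      exact hP3 _ _ (by omega) (by omega) (by omega) (by omega)
    have e2 : P i ᵥ* petrie N ρ = G (max (σ (i.1 + 1)) (σ (i.1 + 2)))
        - G (min (σ (i.1 + 1)) (σ (i.1 + 2))) := hG1 (i.1 + 1) (by omega) (by omega)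
    rw [e1, e2]
  have hPu : IsUnit P := by
    rw [← Matrix.vecMul_surjective_iff_isUnit]
    change Function.Surjective P.vecMulLinear
    rw [← LinearMap.range_eq_top]
    apply submodule_eq_top_of_edges
    apply hG2
    · rintro _ ⟨x, rfl⟩
      refine ⟨x ᵥ* petrie N σ, ?_⟩
      simp only [hTdef, Matrix.vecMulLinear_apply, Matrix.vecMul_vecMul, hcomm]
    · intro i a b
      exact ⟨_, hP1 i a b⟩
  refine ⟨P⁻¹, ?_, ?_⟩
  · rwa [Matrix.isUnit_nonsing_inv_iff]
  · have hdet := (Matrix.isUnit_iff_isUnit_det P).mp hPu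
    rw [Matrix.nonsing_inv_nonsing_inv _ hdet, mul_assoc, hcomm, ← mul_assoc,
      Matrix.nonsing_inv_mul _ hdet, one_mul]

lemma trace_of_similar {p : ℕ} {A B : Matrix (Fin p) (Fin p) ℝ} (h : MatSimilar A B) :
    A.trace = B.trace := by
  obtain ⟨P, hP, rfl⟩ := h
  have hdet := (Matrix.isUnit_iff_isUnit_det P).mp hP
  rw [Matrix.trace_mul_comm, ← mul_assoc, Matrix.nonsing_inv_mul _ hdet, one_mul]

lemma trace_petrie (N : ℕ) (σ : ℕ → ℕ) :
    (petrie N σ).trace = ∑ i ∈ Finset.range (N - 1),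
      if min (σ (i + 1)) (σ (i + 2)) ≤ i + 1 ∧ i + 1 ≤ max (σ (i + 1)) (σ (i + 2)) - 1
      then (1 : ℝ) else 0 := by
  rw [Finset.sum_range]
  rfl

/-- If `σ` has a hit on three different diagonal places and `ρ` only on the first, the traces
differ. -/
lemma trace_ne (N : ℕ) (σ ρ : ℕ → ℕ) (x : ℕ) (hN : 2 ≤ N) (hx : 1 ≤ x) (hxN : x + 1 < N)
    (hρ : ∀ i, 1 ≤ i → i + 1 < N →
      ¬ (min (ρ (i + 1)) (ρ (i + 2)) ≤ i + 1 ∧ i + 1 ≤ max (ρ (i + 1)) (ρ (i + 2)) - 1))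
    (hσ0 : min (σ 1) (σ 2) ≤ 1 ∧ 1 ≤ max (σ 1) (σ 2) - 1)
    (hσx : min (σ (x + 1)) (σ (x + 2)) ≤ x + 1 ∧ x + 1 ≤ max (σ (x + 1)) (σ (x + 2)) - 1) :
    (petrie N σ).trace ≠ (petrie N ρ).trace := by
  rw [trace_petrie, trace_petrie]
  apply ne_of_gt
  apply Finset.sum_lt_sum
  · intro i hi
    rw [Finset.mem_range] at hi
    rcases Nat.eq_zero_or_pos i with h | h
    · subst h
      rw [if_pos (show min (σ (0 + 1)) (σ (0 + 2)) ≤ 0 + 1 ∧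
        0 + 1 ≤ max (σ (0 + 1)) (σ (0 + 2)) - 1 by simpa using hσ0)]
      split_ifs <;> norm_num
    · rw [if_neg (hρ i h (by omega))]
      split_ifs <;> norm_num
  · refine ⟨x, Finset.mem_range.mpr (by omega), ?_⟩
    rw [if_neg (hρ x hx hxN), if_pos hσx]
    norm_num

/-- The left extension (with `m = 1`) used to refute left similarity. -/
def leftExtOf (σ : ℕ → ℕ) : ℕ → ℕ := fun i =>
  if i = 1 then 1 + σ 1 else if i = 2 then 1 else 1 + σ (i - 1)

lemma sigma_one (n k : ℕ) : sigmaNK n k 1 = n := by simp [sigmaNK]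

lemma sigma_up (n k i : ℕ) (hn : 2 ≤ n) (h1 : n ≤ i) (h2 : i ≤ k - 1) :
    sigmaNK n k i = i + 1 := by
  unfold sigmaNK; rw [if_neg (by omega), if_pos ⟨h1, h2⟩]

lemma sigma_top (n k : ℕ) (hk : 2 ≤ k) : sigmaNK n k k = n - 1 := by
  unfold sigmaNK; rw [if_neg (by omega), if_neg (by omega), if_pos rfl]

lemma sigma_down (n k i : ℕ) (hn : n ≤ k) (h1 : 2 ≤ i) (h2 : i ≤ n - 1) :
    sigmaNK n k i = i - 1 := by
  unfold sigmaNK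
  rw [if_neg (by omega), if_neg (by omega), if_neg (by omega), if_pos ⟨h1, h2⟩]

lemma leftExt_perm (n k : ℕ) (hn : 3 ≤ n) (hnk : n ≤ k) :
    IsPermOn (1 + k) (leftExtOf (sigmaNK n k)) := by
  have hmaps : Set.MapsTo (leftExtOf (sigmaNK n k)) (Set.Icc 1 (1 + k)) (Set.Icc 1 (1 + k)) := by
    rintro i ⟨h1, h2⟩
    simp only [leftExtOf, sigmaNK, Set.mem_Icc]
    split_ifs <;> omega
  have hinj : Set.InjOn (leftExtOf (sigmaNK n k)) (Set.Icc 1 (1 + k)) := by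
    rintro i ⟨h1, h2⟩ j ⟨h3, h4⟩ h
    simp only [leftExtOf, sigmaNK] at h
    split_ifs at h <;> omega
  refine ⟨hmaps, hinj, ?_⟩
  have := Finset.surjOn_of_injOn_of_card_le (s := Finset.Icc 1 (1 + k)) (t := Finset.Icc 1 (1 + k))
    (leftExtOf (sigmaNK n k)) (by simpa using hmaps) (by simpa using hinj) le_rfl
  simpa using this

lemma leftExt_isLeftExt (n k : ℕ) (hn : 3 ≤ n) (hnk : n ≤ k) :
    IsLeftExt k 1 (sigmaNK n k) (leftExtOf (sigmaNK n k)) := by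
  refine ⟨leftExt_perm n k hn hnk, ?_, 1, le_rfl, le_rfl, by simp [leftExtOf], ?_⟩
  · intro i h1 h2
    simp only [leftExtOf]
    rw [if_neg (by omega), if_neg (by omega), show 1 + i - 1 = i by omega]
  · intro j h1 h2 h3
    obtain rfl : j = 2 := by omega
    simp [leftExtOf]

lemma right_similar_aux (k n : ℕ) (hn : 3 ≤ n) (hn' : n ≤ k - 1) :
    RightSimilar k (sigmaNK n k) (sigmaNK k k) := by
  intro r hr σ ρ h
  obtain ⟨⟨hσp, hσ, t1, ht1, ht1', hσt1, hσj⟩, ⟨hρp, hρ, t2, ht2, ht2', hρt2, hρj⟩,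
    t, ht, ht', hσt, hρt, hsync⟩ := h
  obtain ⟨d, rfl⟩ : ∃ d, k = n + d := ⟨k - n, by omega⟩
  have c1 : σ 1 = n := by rw [hσ 1 le_rfl (by omega), sigma_one]
  have c2 : ρ 1 = n + d := by rw [hρ 1 le_rfl (by omega), sigma_one]
  rw [sigma_top _ _ (by omega)] at hσt hρt hσt1 hρt2
  have big : ∀ i, i ≠ t → n + d ≤ i → i ≤ n + d + r → σ i = ρ i ∧ n + d < ρ i := by
    intro i h1 h2 h3
    have e := hsync i h1 h2 h3
    refine ⟨e, hρj i ?_ h2 h3⟩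
    rintro rfl
    exact h1 (hρp.injOn (show i ∈ Set.Icc 1 (n + d + r) from ⟨by omega, by omega⟩)
      (show t ∈ Set.Icc 1 (n + d + r) from ⟨by omega, by omega⟩) (by rw [hρt, hρt2]))
  refine similar_of_sync σ ρ 0 n d (n + d + r) hn (by omega) (by omega) hσp hρp ?_ ?_ ?_ ?_ ?_ ?_
  · intro i h1 h2
    obtain rfl : i = 1 := by omega
    right; omega
  · intro i h1 h2
    by_cases h : i = t
    · subst h; right; omega
    · left
      have := big i h (by omega) h2
      omega
  · have := big (n + d) (by omega) le_rfl (by omega)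
    simpa using this
  · intro i h1 h2
    rw [hρ i (by omega) (by omega), sigma_down _ _ _ le_rfl (by omega) (by omega)]
  · intro i h1 h2
    rw [hσ i (by omega) (by omega), sigma_down _ _ _ (by omega) (by omega) (by omega)]
  · intro i h1 h2
    rw [hσ i (by omega) (by omega), sigma_up _ _ _ (by omega) (by omega) (by omega)]

lemma two_sided_aux (k n : ℕ) (hn : 3 ≤ n) (hn' : n ≤ k - 1) :
    TwoSidedSimilar k (sigmaNK n k) (sigmaNK k k) := by
  intro m r hm hr σ ρ h
  obtain ⟨⟨hσp, hσ, -, -⟩, ⟨hρp, hρ, ⟨s2, hs2, hs2', hρs2, hρi⟩, ⟨t2, ht2, ht2', hρt2, hρj⟩⟩,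
    s, t, hs, hs', ht, ht', hσs, hρs, hσt, hρt, hsync⟩ := h
  obtain ⟨d, rfl⟩ : ∃ d, k = n + d := ⟨k - n, by omega⟩
  rw [sigma_top _ _ (by omega)] at hσt hρt hρt2
  rw [sigma_one] at hσs hρs hρs2
  have big : ∀ i, i ≠ t → m + (n + d) ≤ i → i ≤ m + (n + d) + r →
      σ i = ρ i ∧ m + (n + d) < ρ i := by
    intro i h1 h2 h3
    have e := hsync i (by omega) h1 (Or.inr ⟨h2, h3⟩)
    refine ⟨e, hρj i ?_ h2 h3⟩
    rintro rfl
    exact h1 (hρp.injOn (show i ∈ Set.Icc 1 (m + (n + d) + r) from ⟨by omega, by omega⟩)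
      (show t ∈ Set.Icc 1 (m + (n + d) + r) from ⟨by omega, by omega⟩) (by rw [hρt, hρt2]))
  have small : ∀ i, i ≠ s → 1 ≤ i → i ≤ m + 1 → σ i = ρ i ∧ ρ i < m + 1 := by
    intro i h1 h2 h3
    have e := hsync i h1 (by omega) (Or.inl ⟨h2, h3⟩)
    refine ⟨e, hρi i ?_ h2 h3⟩
    rintro rfl
    exact h1 (hρp.injOn (show i ∈ Set.Icc 1 (m + (n + d) + r) from ⟨by omega, by omega⟩)
      (show s ∈ Set.Icc 1 (m + (n + d) + r) from ⟨by omega, by omega⟩) (by rw [hρs, hρs2]))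
  have hσ' : ∀ i, m + 2 ≤ i → i ≤ m + (n + d) - 1 → σ i = m + sigmaNK n (n + d) (i - m) := by
    intro i h1 h2
    have := hσ (i - m) (by omega) (by omega)
    rwa [show m + (i - m) = i by omega] at this
  have hρ' : ∀ i, m + 2 ≤ i → i ≤ m + (n + d) - 1 →
      ρ i = m + sigmaNK (n + d) (n + d) (i - m) := by
    intro i h1 h2
    have := hρ (i - m) (by omega) (by omega)
    rwa [show m + (i - m) = i by omega] at this
  refine similar_of_sync σ ρ m n d (m + (n + d) + r) hn (by omega) (by omega) hσp hρp
    ?_ ?_ ?_ ?_ ?_ ?_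
  · intro i h1 h2
    by_cases h : i = s
    · subst h; right; omega
    · left
      have := small i h h1 h2
      omega
  · intro i h1 h2
    by_cases h : i = t
    · subst h; right; omega
    · left
      exact big i h h1 h2
  · exact big (m + (n + d)) (by omega) le_rfl (by omega)
  · intro i h1 h2
    rw [hρ' i h1 h2, sigma_down _ _ _ le_rfl (by omega) (by omega)]; omega
  · intro i h1 h2
    rw [hσ' i h1 (by omega), sigma_down _ _ _ (by omega) (by omega) (by omega)]; omega
  · intro i h1 h2
    rw [hσ' i (by omega) h2, sigma_up _ _ _ (by omega) (by omega) (by omega)]; omega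

lemma trace_ne_base (k n : ℕ) (hn : 3 ≤ n) (hn' : n ≤ k - 1) :
    (petrie k (sigmaNK n k)).trace ≠ (petrie k (sigmaNK k k)).trace := by
  apply trace_ne k _ _ (n - 2) (by omega) (by omega) (by omega)
  · intro i h1 h2
    simp only [sigmaNK]
    split_ifs <;> omega
  · simp only [sigmaNK]
    split_ifs <;> omega
  · rw [show n - 2 + 1 = n - 1 by omega, show n - 2 + 2 = n by omega,
      sigma_down n k (n - 1) (by omega) (by omega) (by omega),
      sigma_up n k n (by omega) (by omega) (by omega)]
    omega

lemma trace_ne_left (k n : ℕ) (hn : 3 ≤ n) (hn' : n ≤ k - 1) :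
    (petrie (1 + k) (leftExtOf (sigmaNK n k))).trace
      ≠ (petrie (1 + k) (leftExtOf (sigmaNK k k))).trace := by
  apply trace_ne (1 + k) _ _ (n - 1) (by omega) (by omega) (by omega)
  · intro i h1 h2
    simp only [leftExtOf, sigmaNK]
    split_ifs <;> omega
  · have e1 : leftExtOf (sigmaNK n k) 1 = 1 + n := by simp [leftExtOf, sigma_one]
    have e2 : leftExtOf (sigmaNK n k) 2 = 1 := by simp [leftExtOf]
    omega
  · have e1 : leftExtOf (sigmaNK n k) n = n - 1 := by
      simp only [leftExtOf]
      rw [if_neg (by omega), if_neg (by omega),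
        sigma_down n k (n - 1) (by omega) (by omega) (by omega)]
      omega
    have e2 : leftExtOf (sigmaNK n k) (n + 1) = n + 2 := by
      simp only [leftExtOf]
      rw [if_neg (by omega), if_neg (by omega), show n + 1 - 1 = n by omega,
        sigma_up n k n (by omega) (by omega) (by omega)]
      omega
    rw [show n - 1 + 1 = n by omega, show n - 1 + 2 = n + 1 by omega, e1, e2]
    omega

lemma not_left_aux (k n : ℕ) (hn : 3 ≤ n) (hn' : n ≤ k - 1) :
    ¬ LeftSimilar k (sigmaNK n k) (sigmaNK k k) := by
  intro h
  apply trace_ne_left k n hn hn'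
  apply trace_of_similar
  apply h 1 le_rfl
  refine ⟨leftExt_isLeftExt n k hn (by omega), leftExt_isLeftExt k k (by omega) le_rfl,
    1, le_rfl, le_rfl, by simp [leftExtOf], by simp [leftExtOf], ?_⟩
  intro i h1 h2 h3
  obtain rfl : i = 2 := by omega
  simp [leftExtOf]

/-- Theorem 8(3). -/
theorem sigmaNK_sigmaKK_similar (k n : ℕ) (hk : 4 ≤ k) (hn : 3 ≤ n) (hn' : n ≤ k - 1) :
    RightSimilar k (sigmaNK n k) (sigmaNK k k) ∧
    TwoSidedSimilar k (sigmaNK n k) (sigmaNK k k) ∧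
    ¬ LeftSimilar k (sigmaNK n k) (sigmaNK k k) ∧
    (petrie k (sigmaNK n k)).trace ≠ (petrie k (sigmaNK k k)).trace ∧
    ¬ MatSimilar (petrie k (sigmaNK n k)) (petrie k (sigmaNK k k)) := by
  exact ⟨right_similar_aux k n hn hn', two_sided_aux k n hn hn', not_left_aux k n hn hn',
    trace_ne_base k n hn hn', fun h => trace_ne_base k n hn hn' (trace_of_similar h)⟩
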